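/- Let M be a compact metric space, f a continuous flow on M, ν an f-invariant ergodic Borel probability measure, γ : M → (0,∞) continuous, g the time change of f with speed multiplier γ, and τ the additive cocycle over g generated by γ. Then ∫_M τ(1,x) dν^γ(x) = ∫_M γ dν^γ = (∫_M γ^{−1} dν)^{−1}. -/

import Mathlib

open MeasureTheory intervalIntegral

/-- The additive cocycle over the flow `g` generated by `γ`:
`τ(t,x) = ∫₀^t γ(g^s x) ds`. -/
noncomputable def addCocycle {M : Type*} [TopologicalSpace M] (g : Flow ℝ M) (γ : M → ℝ)
    (t : ℝ) (x : M) : ℝ :=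
  ∫ s in (0 : ℝ)..t, γ (g s x)

/-- The flow `g` is a time change of `f` with speed multiplier `γ`. -/
def IsTimeChange {M : Type*} [TopologicalSpace M] (f g : Flow ℝ M) (γ : M → ℝ) : Prop :=
  ∀ t x, g t x = f (addCocycle g γ t x) x

/-- The measure `ν^γ`, with Radon–Nikodym derivative
`dν^γ/dν = γ⁻¹ · (∫ γ⁻¹ dν)⁻¹`. -/
noncomputable def nuGamma {M : Type*} [MeasurableSpace M] (ν : Measure M) (γ : M → ℝ) :
    Measure M :=
  ν.withDensity fun x => ENNReal.ofReal ((γ x)⁻¹ / ∫ y, (γ y)⁻¹ ∂ν)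

section Cocycle

variable {M : Type*} [TopologicalSpace M]

lemma continuous_comp_flow (g : Flow ℝ M) {γ : M → ℝ} (hγ : Continuous γ) (x : M) :
    Continuous fun s => γ (g s x) :=
  hγ.comp (g.continuous continuous_id continuous_const)

lemma hasDerivAt_addCocycle (g : Flow ℝ M) {γ : M → ℝ} (hγ : Continuous γ) (x : M) (t : ℝ) :
    HasDerivAt (fun t => addCocycle g γ t x) (γ (g t x)) t :=
  (continuous_comp_flow g hγ x).integral_hasStrictDerivAt 0 t |>.hasDerivAt

@[simp]
lemma addCocycle_zero (g : Flow ℝ M) (γ : M → ℝ) (x : M) : addCocycle g γ 0 x = 0 := by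
  simp [addCocycle]

lemma continuous_addCocycle (g : Flow ℝ M) {γ : M → ℝ} (hγ : Continuous γ) :
    Continuous fun p : M × ℝ => addCocycle g γ p.2 p.1 := by
  unfold addCocycle
  refine continuous_parametric_intervalIntegral_of_continuous
    (f := fun (p : M × ℝ) s => γ (g s p.1)) ?_ continuous_snd
  exact hγ.comp (g.continuous continuous_snd (continuous_fst.comp continuous_fst))

/-- The cocycle identity. -/
lemma addCocycle_add (g : Flow ℝ M) {γ : M → ℝ} (hγ : Continuous γ) (u v : ℝ) (x : M) :
    addCocycle g γ (u + v) x = addCocycle g γ u x + addCocycle g γ v (g u x) := by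
  have hc := continuous_comp_flow g hγ x
  have h : addCocycle g γ v (g u x) = ∫ s in u..(u + v), γ (g s x) := by
    simp only [addCocycle, ← g.map_add]
    rw [intervalIntegral.integral_comp_add_right (fun s => γ (g s x))]
    simp [add_comm]
  rw [h, addCocycle, addCocycle,
    integral_add_adjacent_intervals (hc.intervalIntegrable _ _) (hc.intervalIntegrable _ _)]

lemma strictMono_addCocycle (g : Flow ℝ M) {γ : M → ℝ} (hγ : Continuous γ)
    (hpos : ∀ x, 0 < γ x) (x : M) : StrictMono fun t => addCocycle g γ t x :=
  strictMono_of_hasDerivAt_pos (hasDerivAt_addCocycle g hγ x) fun _ => hpos _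

variable {f g : Flow ℝ M} {γ : M → ℝ}

/-- The cocycle generated by `γ⁻¹` over `f` is a left inverse of the one generated by `γ` over
the time change. -/
lemma IsTimeChange.addCocycle_inv_addCocycle (hg : IsTimeChange f g γ) (hγ : Continuous γ)
    (hpos : ∀ x, 0 < γ x) (t : ℝ) (x : M) :
    addCocycle f (fun y => (γ y)⁻¹) (addCocycle g γ t x) x = t := by
  have hγi : Continuous fun y => (γ y)⁻¹ := hγ.inv₀ fun y => (hpos y).ne'
  have hd (u : ℝ) : HasDerivAt
      (fun u => addCocycle f (fun y => (γ y)⁻¹) (addCocycle g γ u x) x - u) 0 u := by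
    have h := ((hasDerivAt_addCocycle f hγi x (addCocycle g γ u x)).comp u
      (hasDerivAt_addCocycle g hγ x u)).sub (hasDerivAt_id u)
    rw [← hg u x, inv_mul_cancel₀ (hpos _).ne', sub_self] at h
    exact h
  have h := is_const_of_deriv_eq_zero (fun u => (hd u).differentiableAt) (fun u => (hd u).deriv) t 0
  simpa [sub_eq_zero] using h

lemma IsTimeChange.flow_eq (hg : IsTimeChange f g γ) (hγ : Continuous γ)
    (hpos : ∀ x, 0 < γ x) (s : ℝ) (x : M) :
    f s x = g (addCocycle f (fun y => (γ y)⁻¹) s x) x := by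
  have hγi : Continuous fun y => (γ y)⁻¹ := hγ.inv₀ fun y => (hpos y).ne'
  rw [hg]
  congr 1
  exact ((strictMono_addCocycle f hγi (fun y => inv_pos.2 (hpos y)) x).injective
    (hg.addCocycle_inv_addCocycle hγ hpos _ x)).symm

lemma hasDerivAt_integral_addCocycle (g : Flow ℝ M) (hγ : Continuous γ) (x : M) (u : ℝ) :
    HasDerivAt (fun u => ∫ v in (0 : ℝ)..1, addCocycle g γ v (g u x))
      (addCocycle g γ 1 (g u x) - γ (g u x)) u := by
  have hc : Continuous fun v => addCocycle g γ v x :=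
    (continuous_addCocycle g hγ).comp (continuous_const.prodMk continuous_id)
  have key : (fun u => ∫ v in (0 : ℝ)..1, addCocycle g γ v (g u x)) = fun u =>
      (∫ w in (0 : ℝ)..(u + 1), addCocycle g γ w x) - (∫ w in (0 : ℝ)..u, addCocycle g γ w x)
        - addCocycle g γ u x := by
    funext u
    have h (v : ℝ) : addCocycle g γ v (g u x) = addCocycle g γ (u + v) x - addCocycle g γ u x := by
      rw [addCocycle_add g hγ]; ring
    simp only [h]
    have hcu : Continuous fun v => addCocycle g γ (u + v) x := hc.comp (by fun_prop)
    rw [intervalIntegral.integral_sub (hcu.intervalIntegrable _ _) intervalIntegrable_const,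
      intervalIntegral.integral_comp_add_left (fun w => addCocycle g γ w x),
      integral_interval_sub_left (hc.intervalIntegrable _ _) (hc.intervalIntegrable _ _)]
    simp
  rw [key]
  have hI (b : ℝ) := (hc.integral_hasStrictDerivAt 0 b).hasDerivAt
  have h := (((hI (u + 1)).comp_add_const u 1).sub (hI u)).sub (hasDerivAt_addCocycle g hγ x u)
  rw [addCocycle_add g hγ, add_sub_cancel_left] at h
  exact h

/-- Along `f`-orbits, `τ(1,·)/γ - 1` is the derivative of `∫₀¹ τ(v,·) dv`. -/
lemma IsTimeChange.hasDerivAt_integral_addCocycle (hg : IsTimeChange f g γ) (hγ : Continuous γ)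
    (hpos : ∀ x, 0 < γ x) (x : M) (s : ℝ) :
    HasDerivAt (fun s => ∫ v in (0 : ℝ)..1, addCocycle g γ v (f s x))
      (addCocycle g γ 1 (f s x) / γ (f s x) - 1) s := by
  have hγi : Continuous fun y => (γ y)⁻¹ := hγ.inv₀ fun y => (hpos y).ne'
  have h := (_root_.hasDerivAt_integral_addCocycle g hγ x _).comp s
    (hasDerivAt_addCocycle f hγi x s)
  simp only [Function.comp_def, ← hg.flow_eq hγ hpos] at h
  rwa [← div_eq_mul_inv, sub_div, div_self (hpos _).ne'] at h

end Cocycle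

/-- A continuous function which is a derivative along the orbits of a measure-preserving flow
has zero mean. -/
lemma integral_eq_zero_of_hasDerivAt_flow {M : Type*} [MetricSpace M] [CompactSpace M]
    [MeasurableSpace M] [BorelSpace M] (f : Flow ℝ M) (ν : Measure M) [IsFiniteMeasure ν]
    (hinv : ∀ t : ℝ, MeasurePreserving (f t) ν ν) {φ H : M → ℝ} (hφ : Continuous φ)
    (hH : Continuous H) (hd : ∀ x s, HasDerivAt (fun s => H (f s x)) (φ (f s x)) s) :
    ∫ x, φ x ∂ν = 0 := by
  have hint {h : M → ℝ} (hh : Continuous h) : Integrable h ν :=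
    hh.integrable_of_hasCompactSupport (HasCompactSupport.of_compactSpace h)
  have hmap {h : M → ℝ} (hh : Continuous h) (t : ℝ) : ∫ x, h (f t x) ∂ν = ∫ x, h x ∂ν := by
    rw [← integral_map (hinv t).measurable.aemeasurable hh.aestronglyMeasurable, (hinv t).map_eq]
  have hcφ : Continuous fun p : ℝ × M => φ (f p.1 p.2) :=
    hφ.comp (f.continuous continuous_fst continuous_snd)
  have hFTC (x : M) : ∫ s in (0 : ℝ)..1, φ (f s x) = H (f 1 x) - H x := by
    rw [integral_eq_sub_of_hasDerivAt (fun s _ => hd x s)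
      ((continuous_comp_flow f hφ x).intervalIntegrable _ _), f.map_zero_apply]
  obtain ⟨C, hC⟩ := isCompact_univ.exists_bound_of_continuousOn hφ.continuousOn
  have hfin : IsFiniteMeasure (volume.restrict (Set.uIoc (0 : ℝ) 1)) := by
    rw [Set.uIoc_of_le zero_le_one]; infer_instance
  have hprod : Integrable (Function.uncurry fun (s : ℝ) (x : M) => φ (f s x))
      ((volume.restrict (Set.uIoc 0 1)).prod ν) :=
    Integrable.of_bound hcφ.aestronglyMeasurable C (.of_forall fun p => hC _ (Set.mem_univ _))
  calc ∫ x, φ x ∂ν = ∫ s in (0 : ℝ)..1, (∫ x, φ (f s x) ∂ν) := by simp [hmap hφ]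
    _ = ∫ x, (∫ s in (0 : ℝ)..1, φ (f s x)) ∂ν := intervalIntegral_integral_swap hprod
    _ = ∫ x, (H (f 1 x) - H x) ∂ν := by simp only [hFTC]
    _ = 0 := by
      rw [integral_sub (hint (h := fun x => H (f 1 x))
        (hH.comp (f.continuous continuous_const continuous_id))) (hint hH), hmap hH, sub_self]

lemma integral_nuGamma {M : Type*} [MeasurableSpace M] (ν : Measure M) {γ : M → ℝ}
    (hγ : Measurable γ) (hpos : ∀ x, 0 < γ x) (h : M → ℝ) :
    ∫ x, h x ∂(nuGamma ν γ) = (∫ x, (γ x)⁻¹ ∂ν)⁻¹ * ∫ x, h x / γ x ∂ν := by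
  have hc : 0 ≤ ∫ x, (γ x)⁻¹ ∂ν := integral_nonneg fun x => (inv_pos.2 (hpos x)).le
  have hm : Measurable fun x => ENNReal.ofReal ((γ x)⁻¹ / ∫ y, (γ y)⁻¹ ∂ν) :=
    (hγ.inv.div_const _).ennreal_ofReal
  rw [nuGamma, integral_withDensity_eq_integral_toReal_smul hm (.of_forall fun _ => ENNReal.ofReal_lt_top),
    ← MeasureTheory.integral_const_mul]
  refine integral_congr_ae (.of_forall fun x => ?_)
  simp only [smul_eq_mul]
  rw [ENNReal.toReal_ofReal (div_nonneg (inv_pos.2 (hpos x)).le hc)]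
  ring

/-- With `τ` the additive cocycle over the time change `g` generated by `γ`,
`∫ τ(1,x) dν^γ(x) = ∫ γ dν^γ = (∫ γ⁻¹ dν)⁻¹`. -/
theorem stmt8 {M : Type*} [MetricSpace M] [CompactSpace M]
    [MeasurableSpace M] [BorelSpace M]
    (f g : Flow ℝ M) (γ : M → ℝ) (hγc : Continuous γ) (hγpos : ∀ x, 0 < γ x)
    (hg : IsTimeChange f g γ)
    (ν : Measure M) [IsProbabilityMeasure ν]
    (hinv : ∀ t : ℝ, MeasurePreserving (f t) ν ν)
    (herg : ∀ J : Set M, MeasurableSet J → (∀ t : ℝ, f t '' J = J) → ν J = 0 ∨ ν J = 1) :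
    (∫ x, addCocycle g γ 1 x ∂(nuGamma ν γ)) = ∫ x, γ x ∂(nuGamma ν γ) ∧
    (∫ x, γ x ∂(nuGamma ν γ)) = (∫ x, (γ x)⁻¹ ∂ν)⁻¹ := by
  have hτ := continuous_addCocycle g hγc
  have hq : Continuous fun x => addCocycle g γ 1 x / γ x :=
    (hτ.comp (continuous_id.prodMk continuous_const)).div hγc fun x => (hγpos x).ne'
  have hH : Continuous fun x => ∫ v in (0 : ℝ)..1, addCocycle g γ v x :=
    continuous_parametric_intervalIntegral_of_continuous' hτ 0 1
  have hzero := integral_eq_zero_of_hasDerivAt_flow f ν hinv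
    (φ := fun x => addCocycle g γ 1 x / γ x - 1) (hq.sub continuous_const) hH
    (hg.hasDerivAt_integral_addCocycle hγc hγpos)
  rw [integral_sub (hq.integrable_of_hasCompactSupport (HasCompactSupport.of_compactSpace _))
    (integrable_const _), MeasureTheory.integral_const, probReal_univ, one_smul, sub_eq_zero] at hzero
  have hone : ∫ x, γ x ∂(nuGamma ν γ) = (∫ x, (γ x)⁻¹ ∂ν)⁻¹ := by
    simp [integral_nuGamma ν hγc.measurable hγpos, div_self (hγpos _).ne']
  refine ⟨?_, hone⟩
  rw [hone, integral_nuGamma ν hγc.measurable hγpos, hzero, mul_one]
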